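/- There is a universal constant C > 0 such that for every ε > 0, β ∈ (0,1), and integers d ≥ 1, K ≥ 1 (K known but with no bound on the number of time steps), there exists a measurable map M assigning to every infinite set-cardinality stream over users [d] a probability measure on infinite real-valued output sequences, with the outputs up to time t depending only on the first t operations, such that for every T ≥ 1 the induced length-T mechanism is ε-differentially private (user level), and on every infinite stream with total update count at most K, with probability at least 1 − β, the output at every time t ≥ 1 differs from |D_t| by at most C · min( d, K, √( ε^{-1} · K ) · log(t/β) ). -/

import Mathlib

open MeasureTheory

/-- Base-2 logarithm where the argument is clamped below by 2. -/
noncomputable def log2c (z : ℝ) : ℝ := Real.logb 2 (max z 2)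

/-- An operation of a set-cardinality stream over users `Fin d`: a flag
(`true` = insert, `false` = delete) together with the affected subset. -/
def CardOp (d : ℕ) : Type := Bool × Finset (Fin d)

instance {d : ℕ} : MeasurableSpace (CardOp d) := ⊤

/-- Apply a set-cardinality operation to the maintained set. -/
def CardOp.apply {d : ℕ} (D : Finset (Fin d)) (op : CardOp d) : Finset (Fin d) :=
  if op.1 then D ∪ op.2 else D \ op.2

/-- The maintained set after the first `n` operations of an infinite stream. -/
def DcardN {d : ℕ} (x : ℕ → CardOp d) : ℕ → Finset (Fin d)
  | 0 => ∅
  | n + 1 => CardOp.apply (DcardN x n) (x n)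

/-- The maintained set `D_t` after the first `t+1` operations of a finite
stream (time steps 0-indexed). -/
def Dcard {d T : ℕ} (x : Fin T → CardOp d) (t : Fin T) : Finset (Fin d) :=
  DcardN (fun n => if h : n < T then x ⟨n, h⟩ else ((true, ∅) : CardOp d)) (t.1 + 1)

/-- The total update count of a finite stream: the total number of
(element, time step) pairs such that the element is inserted or deleted at
that time step. -/
def updateCount {d T : ℕ} (x : Fin T → CardOp d) : ℕ :=
  ∑ t : Fin T, (x t).2.card

/-- Two streams are user-level neighboring if removing some single user from
every operation of both streams yields identical streams. -/
def UserNeighboring {d T : ℕ} (x y : Fin T → CardOp d) : Prop :=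
  ∃ i : Fin d, ∀ t : Fin T,
    (x t).1 = (y t).1 ∧ (x t).2.erase i = (y t).2.erase i

/-- A continual-observation set-cardinality mechanism: a measurable assignment
of output distributions to input streams whose outputs up to time `t` depend
only on the first `t` operations. -/
def IsCOMech {d T : ℕ} (M : (Fin T → CardOp d) → Measure (Fin T → ℝ)) : Prop :=
  Measurable M ∧ (∀ x, IsProbabilityMeasure (M x)) ∧
    ∀ (t : Fin T) (x y : Fin T → CardOp d), (∀ s, s ≤ t → x s = y s) →
      (M x).map (fun a (s : {s : Fin T // s ≤ t}) => a s.1) =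
      (M y).map (fun a (s : {s : Fin T // s ≤ t}) => a s.1)

/-- `ε`-differential privacy at user level. -/
def IsUserDP {d T : ℕ} (ε : ℝ)
    (M : (Fin T → CardOp d) → Measure (Fin T → ℝ)) : Prop :=
  ∀ x y, UserNeighboring x y → ∀ S : Set (Fin T → ℝ), MeasurableSet S →
    M x S ≤ ENNReal.ofReal (Real.exp ε) * M y S


/-! ### Discrete Laplace noise -/

noncomputable def lapW (η : ℝ) (n : ℤ) : ENNReal := ENNReal.ofReal (Real.exp (-(η * |(n : ℝ)|)))

lemma lapW_tsum_ne_zero (η : ℝ) : ∑' n, lapW η n ≠ 0 := by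
  intro h
  rw [ENNReal.tsum_eq_zero] at h
  have := h 0
  simp [lapW] at this

lemma lapW_tsum_ne_top {η : ℝ} (hη : 0 < η) : ∑' n, lapW η n ≠ ⊤ := by
  have hg : Summable (fun n : ℕ => Real.exp (-(η * (n : ℝ)))) := by
    have := Real.summable_exp_nat_mul_iff (a := -η) |>.2 (by linarith)
    refine this.congr (fun n => ?_)
    congr 1; ring
  have hs : Summable (fun n : ℤ => Real.exp (-(η * |(n : ℝ)|))) := by
    apply Summable.of_nat_of_neg
    · simpa using hg
    · simpa using hg
  exact hs.tsum_ofReal_ne_top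

noncomputable def lapM (η : ℝ) (hη : 0 < η) : Measure ℤ :=
  (PMF.normalize (lapW η) (lapW_tsum_ne_zero η) (lapW_tsum_ne_top hη)).toMeasure

instance (η : ℝ) (hη : 0 < η) : IsProbabilityMeasure (lapM η hη) := by
  unfold lapM; infer_instance

lemma lapM_singleton (η : ℝ) (hη : 0 < η) (n : ℤ) :
    lapM η hη {n} = lapW η n * (∑' n, lapW η n)⁻¹ := by
  unfold lapM
  rw [PMF.toMeasure_apply_singleton _ _ (measurableSet_singleton _), PMF.normalize_apply]

lemma lapM_shift (η : ℝ) (hη : 0 < η) (n v : ℤ) :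
    lapM η hη {n - v} ≤ ENNReal.ofReal (Real.exp (η * |(v : ℝ)|)) * lapM η hη {n} := by
  rw [lapM_singleton, lapM_singleton, ← mul_assoc]
  gcongr
  unfold lapW
  rw [← ENNReal.ofReal_mul (Real.exp_pos _).le, ← Real.exp_add]
  apply ENNReal.ofReal_le_ofReal
  apply Real.exp_le_exp.2
  have h : |(n : ℝ)| ≤ |((n - v : ℤ) : ℝ)| + |(v : ℝ)| := by
    have := abs_add_le ((n - v : ℤ) : ℝ) (v : ℝ)
    push_cast at this ⊢
    simpa using this
  nlinarith

lemma lapM_tail (η : ℝ) (hη : 0 < η) (B : ℝ) (hB : 0 ≤ B) :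
    lapM η hη {n | B < |(n : ℝ)|} ≤ 2 * ENNReal.ofReal (Real.exp (-(η * B))) := by
  set m : ℕ := ⌈B⌉₊ with hm
  have hmB : B ≤ m := Nat.le_ceil B
  have hsub : {n : ℤ | B < |(n : ℝ)|} ⊆
      (⋃ k : ℕ, {((m : ℤ) + k)}) ∪ (⋃ k : ℕ, {(-(m : ℤ) - k)}) := by
    intro n hn
    simp only [Set.mem_ofPred_eq] at hn
    have h2 : m ≤ n.natAbs := by
      rw [hm, Nat.ceil_le]
      have : ((n.natAbs : ℕ) : ℝ) = |(n : ℝ)| := by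
        rw [← Int.cast_abs, Int.abs_eq_natAbs]; simp
      rw [this]; exact hn.le
    rcases le_total 0 n with h | h
    · left
      simp only [Set.mem_iUnion, Set.mem_singleton_iff]
      exact ⟨n.natAbs - m, by omega⟩
    · right
      simp only [Set.mem_iUnion, Set.mem_singleton_iff]
      exact ⟨n.natAbs - m, by omega⟩
  have key : ∀ f : ℕ → ℤ, (∀ k, |((f k : ℤ) : ℝ)| = m + k) →
      lapM η hη (⋃ k : ℕ, {f k}) ≤ ENNReal.ofReal (Real.exp (-(η * B))) := by
    intro f hf
    calc lapM η hη (⋃ k : ℕ, {f k}) ≤ ∑' k, lapM η hη {f k} := measure_iUnion_le _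
      _ ≤ ∑' k : ℕ, ENNReal.ofReal (Real.exp (-(η * B))) * lapM η hη {(k : ℤ)} := by
        apply ENNReal.tsum_le_tsum
        intro k
        rw [lapM_singleton, lapM_singleton, ← mul_assoc]
        gcongr
        unfold lapW
        rw [← ENNReal.ofReal_mul (Real.exp_pos _).le, ← Real.exp_add]
        apply ENNReal.ofReal_le_ofReal
        apply Real.exp_le_exp.2
        rw [hf]
        have : |(((k : ℕ) : ℤ) : ℝ)| = k := by simp
        rw [this]
        nlinarith
      _ = ENNReal.ofReal (Real.exp (-(η * B))) * ∑' k : ℕ, lapM η hη {(k : ℤ)} :=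
        ENNReal.tsum_mul_left
      _ = ENNReal.ofReal (Real.exp (-(η * B))) * lapM η hη (⋃ k : ℕ, {(k : ℤ)}) := by
        rw [measure_iUnion]
        · intro i j hij
          simp [Function.onFun, hij]
        · intro i; exact measurableSet_singleton _
      _ ≤ ENNReal.ofReal (Real.exp (-(η * B))) * 1 := by
        gcongr
        exact prob_le_one
      _ = _ := mul_one _
  calc _ ≤ _ := measure_mono hsub
    _ ≤ _ := measure_union_le _ _
    _ ≤ ENNReal.ofReal (Real.exp (-(η * B))) + ENNReal.ofReal (Real.exp (-(η * B))) := by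
      apply add_le_add
      · apply key; intro k; push_cast; exact abs_of_nonneg (by positivity)
      · apply key; intro k; push_cast
        rw [show (-(m : ℝ) - k) = -(m + k) by ring, abs_neg]
        exact abs_of_nonneg (by positivity)
    _ = _ := (two_mul _).symm

abbrev NIdx := Fin 3 × ℕ

noncomputable def noiseP (η : ℝ) (hη : 0 < η) : Measure (NIdx → ℤ) :=
  Measure.infinitePi (fun _ => lapM η hη)

instance (η : ℝ) (hη : 0 < η) : IsProbabilityMeasure (noiseP η hη) := by
  unfold noiseP; infer_instance

lemma measure_le_of_singleton {α : Type*} [MeasurableSpace α] [Countable α]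
    [MeasurableSingletonClass α] (μ ν : Measure α) (c : ENNReal)
    (h : ∀ a, μ {a} ≤ c * ν {a}) (s : Set α) : μ s ≤ c * ν s := by
  have hs : MeasurableSet s := s.to_countable.measurableSet
  rw [← Measure.tsum_indicator_apply_singleton μ s hs,
    ← Measure.tsum_indicator_apply_singleton ν s hs, ← ENNReal.tsum_mul_left]
  apply ENNReal.tsum_le_tsum
  intro a
  by_cases ha : a ∈ s <;> simp [ha, h a]

lemma noise_shift (η : ℝ) (hη : 0 < η) (I : Finset NIdx) (v : NIdx → ℤ) (c : ℝ)
    (hc : η * ∑ i ∈ I, |(v i : ℝ)| ≤ c) (B : Set (NIdx → ℤ))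
    (hB : ∀ ω ω' : NIdx → ℤ, (∀ i ∈ I, ω i = ω' i) → ω ∈ B → ω' ∈ B) :
    noiseP η hη {ω | (fun i => ω i + v i) ∈ B} ≤ ENNReal.ofReal (Real.exp c) * noiseP η hη B := by
  classical
  set B' : Set (I → ℤ) := I.restrict '' B with hB'
  have h1 : B = cylinder I B' := by
    ext ω
    simp only [mem_cylinder, hB', Set.mem_image]
    constructor
    · intro h; exact ⟨ω, h, rfl⟩
    · rintro ⟨ω', h, e⟩
      refine hB ω' ω (fun i hi => ?_) h
      exact congrFun e ⟨i, hi⟩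
  have h2 : {ω | (fun i => ω i + v i) ∈ B} = cylinder I {u | (fun i => u i + v i) ∈ B'} := by
    rw [h1]
    ext ω
    simp only [mem_cylinder, Set.mem_ofPred_eq]
    rfl
  have hm : ∀ s : Set (I → ℤ), MeasurableSet s := fun s => s.to_countable.measurableSet
  rw [h2, h1]
  unfold noiseP
  rw [Measure.infinitePi_cylinder _ (hm _), Measure.infinitePi_cylinder _ (hm _)]
  have hmeas : Measurable (fun (u : I → ℤ) (i : I) => u i + v i) := 
    measurable_pi_lambda _ (fun i => (measurable_pi_apply i).add_const _)
  have h3 : Measure.pi (fun _ : I => lapM η hη) {u | (fun i => u i + v i) ∈ B'} =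
      (Measure.pi (fun _ : I => lapM η hη)).map (fun (u : I → ℤ) (i : I) => u i + v i) B' := by
    rw [Measure.map_apply hmeas (hm _)]; rfl
  rw [h3]
  apply measure_le_of_singleton
  intro a
  rw [Measure.map_apply hmeas (hm _)]
  have h4 : (fun (u : I → ℤ) (i : I) => u i + v i) ⁻¹' {a} = {fun i => a i - v i} := by
    ext u
    simp only [Set.mem_preimage, Set.mem_singleton_iff, funext_iff]
    exact forall_congr' fun i => by constructor <;> intro h <;> omega
  rw [h4, Measure.pi_singleton, Measure.pi_singleton]
  calc ∏ i : I, lapM η hη {a i - v i}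
      ≤ ∏ i : I, (ENNReal.ofReal (Real.exp (η * |(v i : ℝ)|)) * lapM η hη {a i}) :=
        Finset.prod_le_prod' (fun i _ => lapM_shift η hη _ _)
    _ = ENNReal.ofReal (Real.exp (η * ∑ i ∈ I, |(v i : ℝ)|)) * ∏ i : I, lapM η hη {a i} := by
      rw [Finset.prod_mul_distrib]
      congr 1
      rw [← ENNReal.ofReal_prod_of_nonneg (fun i _ => (Real.exp_pos _).le), ← Real.exp_sum,
        ← Finset.mul_sum, Finset.sum_coe_sort I (fun i => |(v i : ℝ)|)]
    _ ≤ _ := by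
      gcongr

/-! ### The sparse vector state machine -/

open Classical in
noncomputable def svSt (S : ℕ) (θ : ℕ → ℝ) (Q : ℕ → ℤ) (ω : NIdx → ℤ) : ℕ → ℤ × ℕ
  | 0 => (0, 0)
  | t + 1 =>
    if (svSt S θ Q ω t).2 < S ∧ θ t + (ω (0, (svSt S θ Q ω t).2) : ℝ) <
        |((Q t - (svSt S θ Q ω t).1 : ℤ) : ℝ)| + (ω (1, t) : ℝ) then
      (Q t + ω (2, t), (svSt S θ Q ω t).2 + 1)
    else svSt S θ Q ω t

lemma svSt_count_le (S : ℕ) (θ : ℕ → ℝ) (Q : ℕ → ℤ) (ω : NIdx → ℤ) (t : ℕ) :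
    (svSt S θ Q ω t).2 ≤ t ∧ (svSt S θ Q ω t).2 ≤ S := by
  induction t with
  | zero => simp [svSt]
  | succ t ih =>
    rw [svSt]
    split_ifs with h
    · have := h.1
      simp only
      omega
    · omega

lemma svSt_congr (S : ℕ) (θ : ℕ → ℝ) (Q Q' : ℕ → ℤ) (ω ω' : NIdx → ℤ) (N t : ℕ) (ht : t ≤ N)
    (hQ : ∀ s < t, Q s = Q' s)
    (hω : ∀ i ∈ (Finset.univ ×ˢ Finset.range N : Finset NIdx), ω i = ω' i) :
    svSt S θ Q ω t = svSt S θ Q' ω' t := by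
  induction t with
  | zero => simp [svSt]
  | succ t ih =>
    have ih' := ih (by omega) (fun s hs => hQ s (by omega))
    have hc := (svSt_count_le S θ Q' ω' t).1
    rw [svSt, svSt, ih', hQ t (by omega), hω (0, _) (by simp; omega), hω (1, t) (by simp; omega),
      hω (2, t) (by simp; omega)]

/-- Noise shift aligning the runs on `Q` and `Q'`. -/
noncomputable def svShift (S : ℕ) (Q Q' : ℕ → ℤ) (p : ℕ → ℤ × ℕ) (i : NIdx) : ℤ :=
  if i.1 = 0 then (if i.2 < S then 1 else 0)
  else if (p (i.2 + 1)).2 = (p i.2).2 then 0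
  else if i.1 = 1 then 2 else Q i.2 - Q' i.2

lemma svSt_shift (S : ℕ) (θ : ℕ → ℝ) (Q Q' : ℕ → ℤ) (ω : NIdx → ℤ) (p : ℕ → ℤ × ℕ) (T : ℕ)
    (hQ : ∀ t < T, |Q t - Q' t| ≤ 1) (hp : ∀ s ≤ T, svSt S θ Q ω s = p s) (t : ℕ) (ht : t ≤ T) :
    svSt S θ Q' (fun i => ω i + svShift S Q Q' p i) t = p t := by
  induction t with
  | zero => rw [← hp 0 (by omega)]; simp [svSt]
  | succ t ih =>
    have ih' := ih (by omega)
    have h1 := hp t (by omega)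
    have h2 := hp (t + 1) ht
    have hq : |((Q t : ℤ) : ℝ) - (Q' t : ℝ)| ≤ 1 := by exact_mod_cast hQ t (by omega)
    have ha : |(|((Q t - (p t).1 : ℤ) : ℝ)| - |((Q' t - (p t).1 : ℤ) : ℝ)|)| ≤ 1 := by
      refine (abs_abs_sub_abs_le_abs_sub _ _).trans ?_
      push_cast
      simpa using hq
    rw [abs_le] at ha
    rw [svSt, h1] at h2
    rw [svSt, ih']
    by_cases hS : (p t).2 < S
    · have v0 : svShift S Q Q' p (0, (p t).2) = 1 := by simp [svShift, hS]
      simp only [v0, hS, true_and] at h2 ⊢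
      split_ifs at h2 with hc
      · have hne : ¬ (p (t + 1)).2 = (p t).2 := by rw [← h2]; simp
        have v1 : svShift S Q Q' p (1, t) = 2 := by simp [svShift, hne]
        have v2 : svShift S Q Q' p (2, t) = Q t - Q' t := by simp [svShift, hne]
        rw [v1, v2, if_pos]
        · rw [← h2]
          ext
          · simp only; ring
          · rfl
        · push_cast at *
          linarith [ha.1, ha.2]
      · have he : (p (t + 1)).2 = (p t).2 := by rw [← h2]
        have v1 : svShift S Q Q' p (1, t) = 0 := by simp [svShift, he]
        rw [v1, if_neg, ← h2]
        push_cast at *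
        linarith [ha.1, ha.2]
    · simp only [hS, false_and, if_false] at h2 ⊢
      exact h2

lemma svShift_cost (S : ℕ) (θ : ℕ → ℝ) (Q Q' : ℕ → ℤ) (ω : NIdx → ℤ) (T : ℕ)
    (hQ : ∀ t < T, |Q t - Q' t| ≤ 1) :
    ∑ i ∈ (Finset.univ ×ˢ Finset.range T : Finset NIdx),
      |(svShift S Q Q' (svSt S θ Q ω) i : ℝ)| ≤ 4 * S := by
  rw [Finset.sum_product, Fin.sum_univ_three]
  have h0 : ∑ t ∈ Finset.range T, |(svShift S Q Q' (svSt S θ Q ω) (0, t) : ℝ)| ≤ S := by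
    have : ∀ t, |(svShift S Q Q' (svSt S θ Q ω) (0, t) : ℝ)| = if t < S then 1 else 0 := by
      intro t
      by_cases h : t < S <;> simp [svShift, h]
    simp only [this]
    rw [Finset.sum_boole]
    have : ((Finset.range T).filter (fun t => t < S)) ⊆ Finset.range S := by
      intro t; simp
    have := Finset.card_le_card this
    rw [Finset.card_range] at this
    exact_mod_cast this
  have h12 : ∑ t ∈ Finset.range T, |(svShift S Q Q' (svSt S θ Q ω) (1, t) : ℝ)| +
      ∑ t ∈ Finset.range T, |(svShift S Q Q' (svSt S θ Q ω) (2, t) : ℝ)| ≤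
      3 * (svSt S θ Q ω T).2 := by
    clear h0
    induction T with
    | zero => simp [svSt]
    | succ T ih =>
      have ih' := ih (fun t ht => hQ t (by omega))
      have hq : |((Q T : ℤ) : ℝ) - (Q' T : ℝ)| ≤ 1 := by exact_mod_cast hQ T (by omega)
      rw [Finset.sum_range_succ, Finset.sum_range_succ]
      by_cases he : (svSt S θ Q ω (T + 1)).2 = (svSt S θ Q ω T).2
      · have v1 : svShift S Q Q' (svSt S θ Q ω) (1, T) = 0 := by simp [svShift, he]
        have v2 : svShift S Q Q' (svSt S θ Q ω) (2, T) = 0 := by simp [svShift, he]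
        rw [v1, v2, he]
        simpa using ih'
      · have v1 : svShift S Q Q' (svSt S θ Q ω) (1, T) = 2 := by simp [svShift, he]
        have v2 : svShift S Q Q' (svSt S θ Q ω) (2, T) = Q T - Q' T := by simp [svShift, he]
        have hc : (svSt S θ Q ω (T + 1)).2 = (svSt S θ Q ω T).2 + 1 := by
          rw [svSt] at he ⊢
          split_ifs at he ⊢ with h
          · rfl
          · exact absurd rfl he
        rw [v1, v2, hc]
        push_cast
        rw [abs_of_pos (by norm_num : (0:ℝ) < 2)]
        linarith
  have h3 : ((svSt S θ Q ω T).2 : ℝ) ≤ S := by exact_mod_cast (svSt_count_le S θ Q ω T).2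
  linarith

/-! ### Deterministic accuracy -/

lemma svSt_inv (S : ℕ) (B : ℕ → ℝ) (b K : ℝ) (Q : ℕ → ℤ) (U : ℕ → ℝ) (ω : NIdx → ℤ)
    (hB : Monotone B) (hb : 0 < b) (hbB : ∀ t, b ≤ B t)
    (hS : ∀ c : ℕ, c * b ≤ K → c ≤ S)
    (hU0 : |(Q 0 : ℝ)| ≤ U 0) (hU : ∀ t, |(Q (t + 1) : ℝ) - Q t| ≤ U (t + 1) - U t)
    (hUK : ∀ t, U t ≤ K)
    (hω : ∀ j t, |(ω (j, t) : ℝ)| ≤ B t) (t : ℕ) :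
    |((svSt S (fun t => 4 * B t) Q ω (t + 1)).1 : ℝ) - Q t| ≤ 6 * B t ∧
    ∃ q : ℝ, |((svSt S (fun t => 4 * B t) Q ω (t + 1)).1 : ℝ) - q| ≤ B t ∧
      (svSt S (fun t => 4 * B t) Q ω (t + 1)).2 * b + |Q t - q| ≤ U t := by
  -- a generic step
  have step : ∀ t, (∃ q : ℝ, |((svSt S (fun t => 4 * B t) Q ω t).1 : ℝ) - q| ≤ B t ∧
      (svSt S (fun t => 4 * B t) Q ω t).2 * b + |Q t - q| ≤ U t) →
      |((svSt S (fun t => 4 * B t) Q ω (t + 1)).1 : ℝ) - Q t| ≤ 6 * B t ∧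
      ∃ q : ℝ, |((svSt S (fun t => 4 * B t) Q ω (t + 1)).1 : ℝ) - q| ≤ B t ∧
      (svSt S (fun t => 4 * B t) Q ω (t + 1)).2 * b + |Q t - q| ≤ U t := by
    intro t ⟨q, h1, h2⟩
    have hct := (svSt_count_le S (fun t => 4 * B t) Q ω t).1
    have hcS := (svSt_count_le S (fun t => 4 * B t) Q ω t).2
    rw [svSt]
    set r := (svSt S (fun t => 4 * B t) Q ω t).1 with hr
    set c := (svSt S (fun t => 4 * B t) Q ω t).2 with hc
    have hρ : |(ω (0, c) : ℝ)| ≤ B t := (hω 0 c).trans (hB hct)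
    have hν := hω 1 t
    have hγ := hω 2 t
    have hBt := hbB t
    have tri : |((Q t - r : ℤ) : ℝ)| ≤ |(Q t : ℝ) - q| + |(r : ℝ) - q| := by
      push_cast
      rw [abs_sub_comm (r : ℝ) q]
      exact abs_sub_le _ _ _
    rw [abs_le] at hρ hν
    have hsw : 4 * B t + (ω (0, c) : ℝ) < |((Q t - r : ℤ) : ℝ)| + (ω (1, t) : ℝ) →
        ((c + 1 : ℕ) : ℝ) * b ≤ U t := by
      intro h
      push_cast
      nlinarith [hρ.1, hρ.2, hν.1, hν.2]
    split_ifs with h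
    · have := hsw h.2
      refine ⟨?_, Q t, ?_, ?_⟩
      · push_cast; simp only [add_sub_cancel_left]; linarith
      · push_cast; simp only [add_sub_cancel_left]; linarith
      · simpa using this
    · have hn : ¬ (4 * B t + (ω (0, c) : ℝ) < |((Q t - r : ℤ) : ℝ)| + (ω (1, t) : ℝ)) := by
        intro h'
        have h3 := hS (c + 1) ((hsw h').trans (hUK t))
        exact h ⟨by omega, h'⟩
      refine ⟨?_, q, h1, h2⟩
      rw [abs_sub_comm]
      push_cast at hn
      linarith [hρ.1, hρ.2, hν.1, hν.2]
  induction t with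
  | zero =>
    apply step
    refine ⟨0, ?_, ?_⟩
    · simp [svSt]; linarith [hbB 0]
    · simpa [svSt] using hU0
  | succ t ih =>
    apply step
    obtain ⟨-, q, h1, h2⟩ := ih
    refine ⟨q, h1.trans (hB (Nat.le_succ t)), ?_⟩
    have := abs_sub_le (Q (t + 1) : ℝ) (Q t) q
    linarith [hU t]

/-! ### Streams -/

lemma apply_card {d : ℕ} (D : Finset (Fin d)) (op : CardOp d) :
    |((CardOp.apply D op).card : ℝ) - D.card| ≤ op.2.card := by
  unfold CardOp.apply
  rw [abs_le]
  split_ifs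
  · have h1 := Finset.card_union_le D op.2
    have h2 := Finset.card_le_card (Finset.subset_union_left (s₁ := D) (s₂ := op.2))
    have h1' : ((D ∪ op.2).card : ℝ) ≤ D.card + op.2.card := by exact_mod_cast h1
    have h2' : (D.card : ℝ) ≤ (D ∪ op.2).card := by exact_mod_cast h2
    constructor <;> linarith
  · have h1 := Finset.le_card_sdiff op.2 D
    have h2 := Finset.card_le_card (Finset.sdiff_subset (s := D) (t := op.2))
    have h1' : (D.card : ℝ) ≤ (D \ op.2).card + op.2.card := by
      have : D.card ≤ (D \ op.2).card + op.2.card := by omega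
      exact_mod_cast this
    have h2' : ((D \ op.2).card : ℝ) ≤ D.card := by exact_mod_cast h2
    constructor <;> linarith

lemma DcardN_congr {d : ℕ} (x y : ℕ → CardOp d) (n : ℕ) (h : ∀ s < n, x s = y s) :
    DcardN x n = DcardN y n := by
  induction n with
  | zero => rfl
  | succ n ih => rw [DcardN, DcardN, ih (fun s hs => h s (by omega)), h n (by omega)]

lemma DcardN_erase {d : ℕ} (x y : ℕ → CardOp d) (i : Fin d) (n : ℕ)
    (h : ∀ t < n, (x t).1 = (y t).1 ∧ (x t).2.erase i = (y t).2.erase i) :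
    (DcardN x n).erase i = (DcardN y n).erase i := by
  induction n with
  | zero => rfl
  | succ n ih =>
    have ih' := ih (fun s hs => h s (by omega))
    obtain ⟨h1, h2⟩ := h n (by omega)
    rw [DcardN, DcardN]
    unfold CardOp.apply
    rw [h1]
    ext j
    have e1 := Finset.ext_iff.1 ih' j
    have e2 := Finset.ext_iff.1 h2 j
    simp only [Finset.mem_erase] at e1 e2
    split_ifs
    · simp only [Finset.mem_erase, Finset.mem_union]; tauto
    · simp only [Finset.mem_erase, Finset.mem_sdiff]; tauto

lemma card_close {d : ℕ} (A B : Finset (Fin d)) (i : Fin d) (h : A.erase i = B.erase i) :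
    |(A.card : ℤ) - (B.card : ℤ)| ≤ 1 := by
  have h1 := Finset.pred_card_le_card_erase (s := A) (a := i)
  have h2 := Finset.pred_card_le_card_erase (s := B) (a := i)
  have h3 := Finset.card_erase_le (s := A) (a := i)
  have h4 := Finset.card_erase_le (s := B) (a := i)
  rw [h] at h1 h3
  rw [abs_le]
  omega

/-- The query sequence. -/
def qSeq {d : ℕ} (x : ℕ → CardOp d) (t : ℕ) : ℤ := ((DcardN x (t + 1)).card : ℤ)

lemma measurable_qSeq {d : ℕ} (t : ℕ) : Measurable (fun x : ℕ → CardOp d => qSeq x t) := by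
  let _ : MeasurableSpace (Finset (Fin d)) := ⊤
  have : DiscreteMeasurableSpace (Finset (Fin d)) := ⟨fun _ => trivial⟩
  have : DiscreteMeasurableSpace (CardOp d) := ⟨fun _ => trivial⟩
  have : Countable (CardOp d) := inferInstanceAs (Countable (Bool × Finset (Fin d)))
  have h : ∀ n, Measurable (fun x : ℕ → CardOp d => DcardN x n) := by
    intro n
    induction n with
    | zero => exact measurable_const
    | succ n ih =>
      have : (fun x : ℕ → CardOp d => DcardN x (n + 1)) =
        (fun p : Finset (Fin d) × CardOp d => CardOp.apply p.1 p.2) ∘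
          (fun x : ℕ → CardOp d => (DcardN x n, x n)) := rfl
      rw [this]
      exact Measurable.of_discrete.comp (ih.prodMk (measurable_pi_apply n))
  exact (Measurable.of_discrete (f := fun D : Finset (Fin d) => (D.card : ℤ))).comp (h (t + 1))

lemma measurable_svSt {d : ℕ} (S : ℕ) (θ : ℕ → ℝ) (t : ℕ) :
    Measurable (fun z : (ℕ → CardOp d) × (NIdx → ℤ) => svSt S θ (qSeq z.1) z.2 t) := by
  classical
  induction t with
  | zero => exact measurable_const
  | succ t ih =>
    have e : (fun z : (ℕ → CardOp d) × (NIdx → ℤ) => svSt S θ (qSeq z.1) z.2 (t + 1)) =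
      (fun p : ((ℤ × ℕ) × ℤ) × (ℤ × ℤ × ℤ) =>
        if p.1.1.2 < S ∧ θ t + (p.2.1 : ℝ) <
          |((p.1.2 - p.1.1.1 : ℤ) : ℝ)| + (p.2.2.1 : ℝ) then
        (p.1.2 + p.2.2.2, p.1.1.2 + 1)
        else p.1.1) ∘ (fun z => ((svSt S θ (qSeq z.1) z.2 t, qSeq z.1 t),
          (z.2 (0, (svSt S θ (qSeq z.1) z.2 t).2), z.2 (1, t), z.2 (2, t)))) := by
      funext z
      simp only [Function.comp]
      rw [svSt]
    rw [e]
    have hev : Measurable (fun p : ℕ × (NIdx → ℤ) => p.2 (0, p.1)) :=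
      measurable_from_prod_countable_right (fun c => measurable_pi_apply (X := fun _ : NIdx => ℤ) (0, c))
    refine Measurable.of_discrete.comp (Measurable.prodMk (ih.prodMk
      ((measurable_qSeq t).comp measurable_fst)) (Measurable.prodMk ?_ (Measurable.prodMk ?_ ?_)))
    · exact hev.comp ((measurable_snd.comp ih).prodMk measurable_snd)
    · exact (measurable_pi_apply _).comp measurable_snd
    · exact (measurable_pi_apply _).comp measurable_snd


lemma one_le_log2c (z : ℝ) : 1 ≤ log2c z := by
  unfold log2c
  rw [Real.le_logb_iff_rpow_le (by norm_num) (by positivity)]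
  simp

lemma log2c_mono : Monotone log2c := by
  intro a b h
  unfold log2c
  apply Real.logb_le_logb_of_le (by norm_num) (by positivity)
  exact max_le_max_right _ h

lemma exp_log2c (z : ℝ) (hz : 0 < z) : Real.exp (-(8 * log2c z)) ≤ 1 / 64 * (1 / z ^ 2) := by
  set w := max z 2 with hw
  have hw0 : 0 < w := by positivity
  have hw2 : 2 ≤ w := le_max_right _ _
  have hwz : z ≤ w := le_max_left _ _
  have h1 : Real.log w ≤ log2c z := by
    unfold log2c
    rw [Real.logb, le_div_iff₀ (Real.log_pos (by norm_num))]
    have h2 : Real.log 2 ≤ 1 := by linarith [Real.log_two_lt_d9]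
    have h3 : 0 ≤ Real.log w := Real.log_nonneg (by linarith)
    nlinarith
  calc Real.exp (-(8 * log2c z)) ≤ Real.exp (-(8 * Real.log w)) := by
        apply Real.exp_le_exp.2; linarith
    _ = (w ^ 8)⁻¹ := by
        rw [Real.exp_neg, show (8 : ℝ) * Real.log w = ((8 : ℕ) : ℝ) * Real.log w by norm_num,
          Real.exp_nat_mul, Real.exp_log hw0]
    _ ≤ (64 * z ^ 2)⁻¹ := by
        apply inv_anti₀ (by positivity)
        have e1 : (64 : ℝ) ≤ w ^ 6 := by
          calc (64 : ℝ) = 2 ^ 6 := by norm_num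
            _ ≤ w ^ 6 := by gcongr
        have e2 : z ^ 2 ≤ w ^ 2 := by gcongr
        calc 64 * z ^ 2 ≤ w ^ 6 * w ^ 2 := by gcongr
          _ = w ^ 8 := by ring
    _ = _ := by rw [mul_inv]; ring

lemma noise_good (s β : ℝ) (hs : 0 < s) (hβ : β ∈ Set.Ioo (0 : ℝ) 1) (hη : 0 < 1 / (4 * s)) :
    ENNReal.ofReal (1 - β) ≤ noiseP (1 / (4 * s)) hη
      {ω | ∀ j t, |(ω (j, t) : ℝ)| ≤ 32 * s * log2c (((t : ℝ) + 1) / β)} := by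
  obtain ⟨hβ0, hβ1⟩ := hβ
  set P := noiseP (1 / (4 * s)) hη with hP
  set B : ℕ → ℝ := fun t => 32 * s * log2c (((t : ℝ) + 1) / β) with hBdef
  have hB0 : ∀ t, 0 ≤ B t := fun t => by
    have := one_le_log2c (((t : ℝ) + 1) / β)
    simp only [hBdef]; positivity
  set bad : Fin 3 → ℕ → Set (NIdx → ℤ) := fun j t => {ω | B t < |(ω (j, t) : ℝ)|} with hbad
  have hms : ∀ j t, MeasurableSet (bad j t) := by
    intro j t
    have : bad j t = (fun ω : NIdx → ℤ => ω (j, t)) ⁻¹' {n : ℤ | B t < |(n : ℝ)|} := rfl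
    rw [this]
    exact (measurable_pi_apply _) (Set.to_countable _).measurableSet
  have hb : ∀ j t, P (bad j t) ≤
      ENNReal.ofReal (1 / 32 * β * (1 / ((t + 1 : ℕ) : ℝ) ^ 2)) := by
    intro j t
    have e : P (bad j t) = lapM (1 / (4 * s)) hη {n : ℤ | B t < |(n : ℝ)|} := by
      rw [← Measure.infinitePi_map_eval (fun _ : NIdx => lapM (1 / (4 * s)) hη) (j, t),
        Measure.map_apply (measurable_pi_apply _) (Set.to_countable _).measurableSet]
      rfl
    rw [e]
    refine (lapM_tail _ hη _ (hB0 t)).trans ?_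
    rw [show (2 : ENNReal) = ENNReal.ofReal 2 by simp, ← ENNReal.ofReal_mul (by norm_num)]
    apply ENNReal.ofReal_le_ofReal
    have e2 : 1 / (4 * s) * B t = 8 * log2c (((t : ℝ) + 1) / β) := by
      simp only [hBdef]; field_simp; ring
    rw [e2]
    have e3 := exp_log2c (((t : ℝ) + 1) / β) (by positivity)
    have e4 : 1 / (((t : ℝ) + 1) / β) ^ 2 ≤ β * (1 / ((t + 1 : ℕ) : ℝ) ^ 2) := by
      push_cast
      rw [div_pow, one_div_div, mul_one_div]
      gcongr
      nlinarith
    linarith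
  have hsum : Summable (fun t : ℕ => 1 / 32 * β * (1 / ((t + 1 : ℕ) : ℝ) ^ 2)) := by
    apply Summable.mul_left
    exact (summable_nat_add_iff 1 (f := fun n : ℕ => 1 / (n : ℝ) ^ 2)).2 hasSum_zeta_two.summable
  have hle : ∑' t : ℕ, (1 / 32 * β * (1 / ((t + 1 : ℕ) : ℝ) ^ 2)) ≤ β / 3 := by
    rw [tsum_mul_left]
    have h1 := hasSum_zeta_two.summable.tsum_eq_zero_add
    rw [hasSum_zeta_two.tsum_eq] at h1
    have h2 : ∑' t : ℕ, (1 / ((t + 1 : ℕ) : ℝ) ^ 2) = Real.pi ^ 2 / 6 := by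
      rw [h1]; simp
    rw [h2]
    have h3 := Real.pi_lt_four
    have h4 := Real.pi_pos
    have h5 : Real.pi ^ 2 ≤ 16 := by nlinarith
    nlinarith
  have hbj : ∀ j, P (⋃ t, bad j t) ≤ ENNReal.ofReal (β / 3) := by
    intro j
    calc P (⋃ t, bad j t) ≤ ∑' t, P (bad j t) := measure_iUnion_le _
      _ ≤ ∑' t : ℕ, ENNReal.ofReal (1 / 32 * β * (1 / ((t + 1 : ℕ) : ℝ) ^ 2)) :=
        ENNReal.tsum_le_tsum (hb j)
      _ = ENNReal.ofReal (∑' t : ℕ, (1 / 32 * β * (1 / ((t + 1 : ℕ) : ℝ) ^ 2))) :=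
        (ENNReal.ofReal_tsum_of_nonneg (fun t => by positivity) hsum).symm
      _ ≤ _ := ENNReal.ofReal_le_ofReal hle
  have hball : P (⋃ j, ⋃ t, bad j t) ≤ ENNReal.ofReal β := by
    calc P (⋃ j, ⋃ t, bad j t) ≤ ∑ j, P (⋃ t, bad j t) := measure_iUnion_fintype_le _ _
      _ ≤ ∑ j : Fin 3, ENNReal.ofReal (β / 3) := Finset.sum_le_sum (fun j _ => hbj j)
      _ = ENNReal.ofReal β := by
        rw [← ENNReal.ofReal_sum_of_nonneg (fun _ _ => by positivity)]
        congr 1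
        simp; ring
  have hcompl : {ω : NIdx → ℤ | ∀ j t, |(ω (j, t) : ℝ)| ≤ B t} = (⋃ j, ⋃ t, bad j t)ᶜ := by
    ext ω
    simp [hbad]
  rw [hcompl, prob_compl_eq_one_sub (MeasurableSet.iUnion fun j => MeasurableSet.iUnion (hms j)),
    ENNReal.ofReal_sub _ hβ0.le, ENNReal.ofReal_one]
  exact tsub_le_tsub_left hball _

lemma sv_dp (S : ℕ) (θ : ℕ → ℝ) (η ε : ℝ) (hη : 0 < η) (hε : η * (4 * S) ≤ ε) (Q Q' : ℕ → ℤ)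
    (T : ℕ) (hQ : ∀ t < T, |Q t - Q' t| ≤ 1) (p : Fin T → ℤ × ℕ) :
    noiseP η hη {ω | (fun s : Fin T => svSt S θ Q ω (s.1 + 1)) = p} ≤
      ENNReal.ofReal (Real.exp ε) *
        noiseP η hη {ω | (fun s : Fin T => svSt S θ Q' ω (s.1 + 1)) = p} := by
  rcases Set.eq_empty_or_nonempty {ω | (fun s : Fin T => svSt S θ Q ω (s.1 + 1)) = p} with h | h
  · rw [h]; simp
  obtain ⟨ω₀, h0⟩ := h
  set v := svShift S Q Q' (svSt S θ Q ω₀) with hv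
  have hcost := svShift_cost S θ Q Q' ω₀ T hQ
  have hsub : {ω | (fun s : Fin T => svSt S θ Q ω (s.1 + 1)) = p} ⊆
      {ω | (fun i => ω i + v i) ∈ {ω | (fun s : Fin T => svSt S θ Q' ω (s.1 + 1)) = p}} := by
    intro ω hω
    have h0' : (fun s : Fin T => svSt S θ Q ω₀ (s.1 + 1)) = p := h0
    have hω' : (fun s : Fin T => svSt S θ Q ω (s.1 + 1)) = p := hω
    have hp : ∀ s ≤ T, svSt S θ Q ω s = svSt S θ Q ω₀ s := by
      intro s hs
      rcases s with _ | s
      · simp [svSt]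
      · exact (congrFun hω' ⟨s, hs⟩).trans (congrFun h0' ⟨s, hs⟩).symm
    change (fun s : Fin T => svSt S θ Q' (fun i => ω i + v i) (s.1 + 1)) = p
    rw [← h0']
    funext s
    exact svSt_shift S θ Q Q' ω (svSt S θ Q ω₀) T hQ hp (s.1 + 1) s.2
  refine (measure_mono hsub).trans ?_
  apply noise_shift η hη (Finset.univ ×ˢ Finset.range T) v
  · calc _ ≤ η * (4 * S) := by gcongr
      _ ≤ ε := hε
  · intro ω ω' hω h
    change (fun s : Fin T => svSt S θ Q' ω' (s.1 + 1)) = p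
    rw [← show (fun s : Fin T => svSt S θ Q' ω (s.1 + 1)) = p from h]
    funext s
    exact (svSt_congr S θ Q' Q' ω ω' T (s.1 + 1) s.2 (fun _ _ => rfl) hω).symm

set_option maxHeartbeats 800000

theorem set_cardinality_upper_bound_known_K_unknown_T :
    ∃ C : ℝ, 0 < C ∧
      ∀ (ε β : ℝ) (d K : ℕ), 0 < ε → β ∈ Set.Ioo (0 : ℝ) 1 → 1 ≤ d → 1 ≤ K →
        ∃ M : (ℕ → CardOp d) → Measure (ℕ → ℝ),
          -- a measurable assignment of output distributions
          Measurable M ∧ (∀ x, IsProbabilityMeasure (M x)) ∧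
          -- the outputs up to time t depend only on the first t operations
          (∀ (t : ℕ) (x y : ℕ → CardOp d), (∀ s, s < t → x s = y s) →
            (M x).map (fun a (s : Fin t) => a s.1) =
            (M y).map (fun a (s : Fin t) => a s.1)) ∧
          -- for every T ≥ 1 the induced length-T mechanism is ε-dp (user level)
          (∀ T : ℕ, 1 ≤ T → ∀ x y : ℕ → CardOp d,
            (∃ i : Fin d, ∀ t, t < T →
              (x t).1 = (y t).1 ∧ (x t).2.erase i = (y t).2.erase i) →
            ∀ S : Set (Fin T → ℝ), MeasurableSet S →
              (M x).map (fun a (s : Fin T) => a s.1) S ≤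
                ENNReal.ofReal (Real.exp ε) *
                  (M y).map (fun a (s : Fin T) => a s.1) S) ∧
          -- accuracy on every stream with total update count at most K
          ∀ x : ℕ → CardOp d,
            (∀ n : ℕ, ∑ t ∈ Finset.range n, (x t).2.card ≤ K) →
            ENNReal.ofReal (1 - β) ≤
              M x {a | ∀ n : ℕ, |a n - ((DcardN x (n + 1)).card : ℝ)| ≤
                C * min (d : ℝ) (min (K : ℝ)
                  (Real.sqrt (ε⁻¹ * (K : ℝ)) * log2c (((n : ℝ) + 1) / β)))} := by
  classical
  refine ⟨192, by norm_num, ?_⟩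
  intro ε β d K hε hβ hd hK
  have hK0 : (0 : ℝ) < K := by exact_mod_cast hK
  set s : ℝ := Real.sqrt (ε⁻¹ * (K : ℝ)) with hs
  have hs0 : 0 < s := Real.sqrt_pos.2 (by positivity)
  have hss : s * s = ε⁻¹ * K := Real.mul_self_sqrt (by positivity)
  have hη : 0 < 1 / (4 * s) := by positivity
  set S : ℕ := ⌊(K : ℝ) / s⌋₊ with hS
  set L : ℕ → ℝ := fun n => log2c (((n : ℝ) + 1) / β) with hL
  set B : ℕ → ℝ := fun t => 32 * s * L t with hB
  set θ : ℕ → ℝ := fun t => 4 * B t with hθ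
  have hL1 : ∀ n, 1 ≤ L n := fun n => one_le_log2c _
  set g : ℕ → ℤ → ℝ := fun n r => if min (d : ℝ) K ≤ s * L n then 0 else (r : ℝ) with hg
  set out : (ℕ → CardOp d) → (NIdx → ℤ) → ℕ → ℝ :=
    fun x ω n => g n (svSt S θ (qSeq x) ω (n + 1)).1 with hout
  have hjoint : Measurable (fun z : (ℕ → CardOp d) × (NIdx → ℤ) => out z.1 z.2) := by
    apply measurable_pi_lambda
    intro n
    exact (Measurable.of_discrete (f := fun p : ℤ × ℕ => g n p.1)).comp (measurable_svSt S θ (n + 1))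
  have hm : ∀ x, Measurable (out x) := by
    intro x
    have h1 : Measurable (fun ω : NIdx → ℤ => (x, ω)) := measurable_const.prodMk measurable_id
    exact Measurable.comp (g := fun z : (ℕ → CardOp d) × (NIdx → ℤ) => out z.1 z.2)
      (f := fun ω : NIdx → ℤ => (x, ω)) hjoint h1
  set P := noiseP (1 / (4 * s)) hη with hP
  have hrestr : ∀ t : ℕ, Measurable (fun (a : ℕ → ℝ) (s : Fin t) => a s.1) := fun t =>
    measurable_pi_lambda _ (fun i => measurable_pi_apply _)
  refine ⟨fun x => P.map (out x), ?_, ?_, ?_, ?_, ?_⟩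
  · apply Measure.measurable_of_measurable_coe
    intro A hA
    have := measurable_measure_prodMk_left (ν := P) (hjoint hA)
    convert this using 1
    funext x
    rw [Measure.map_apply (hm x) hA]
    rfl
  · intro x
    exact Measure.isProbabilityMeasure_map (hm x).aemeasurable
  · intro t x y hxy
    simp only
    rw [Measure.map_map (hrestr t) (hm x), Measure.map_map (hrestr t) (hm y)]
    congr 1
    funext ω i
    simp only [Function.comp, hout]
    rw [svSt_congr S θ (qSeq x) (qSeq y) ω ω (i.1 + 1) (i.1 + 1) le_rfl ?_ (fun _ _ => rfl)]
    intro u hu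
    unfold qSeq
    rw [DcardN_congr x y (u + 1) (fun w hw => hxy w (by have := i.2; omega))]
  · rintro T hT x y ⟨i, hi⟩ A hA
    simp only
    rw [Measure.map_map (hrestr T) (hm x), Measure.map_map (hrestr T) (hm y)]
    set post : (Fin T → ℤ × ℕ) → (Fin T → ℝ) := fun p u => g u.1 (p u).1 with hpost
    set F : (ℕ → CardOp d) → (NIdx → ℤ) → (Fin T → ℤ × ℕ) :=
      fun x ω u => svSt S θ (qSeq x) ω (u.1 + 1) with hF
    have hFm : ∀ x, Measurable (F x) := fun x => measurable_pi_lambda _ (fun u =>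
      Measurable.comp (g := fun z : (ℕ → CardOp d) × (NIdx → ℤ) => svSt S θ (qSeq z.1) z.2 (u.1 + 1))
        (f := fun ω : NIdx → ℤ => (x, ω)) (measurable_svSt S θ (u.1 + 1))
        (measurable_const.prodMk measurable_id))
    have hpm : Measurable post := by
      apply measurable_pi_lambda
      intro u
      exact (Measurable.of_discrete (f := fun p : ℤ × ℕ => g u.1 p.1)).comp (measurable_pi_apply u)
    have he : ∀ x, (fun (a : ℕ → ℝ) (s : Fin T) => a s.1) ∘ out x = post ∘ F x := fun x => rfl
    rw [he, he, ← Measure.map_map hpm (hFm x), ← Measure.map_map hpm (hFm y),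
      Measure.map_apply hpm hA, Measure.map_apply hpm hA]
    apply measure_le_of_singleton
    intro p
    rw [Measure.map_apply (hFm x) (measurableSet_singleton _),
      Measure.map_apply (hFm y) (measurableSet_singleton _)]
    apply sv_dp S θ (1 / (4 * s)) ε hη
    · have h1 : (S : ℝ) ≤ K / s := Nat.floor_le (by positivity)
      calc 1 / (4 * s) * (4 * S) = S / s := by field_simp
        _ ≤ (K / s) / s := by gcongr
        _ = K / (s * s) := by rw [div_div]
        _ = ε := by rw [hss]; field_simp
        _ ≤ ε := le_rfl
    · intro t ht
      exact card_close _ _ i (DcardN_erase x y i (t + 1) (fun u hu => hi u (by omega)))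
  · intro x hx
    refine le_trans (noise_good s β hs0 hβ hη) ?_
    refine le_trans (measure_mono ?_) (Measure.le_map_apply (hm x).aemeasurable _)
    intro ω hω n
    have hω' : ∀ j t, |(ω (j, t) : ℝ)| ≤ B t := hω
    set U : ℕ → ℝ := fun t => ((∑ u ∈ Finset.range (t + 1), (x u).2.card : ℕ) : ℝ) with hU
    have hUK : ∀ t, U t ≤ K := fun t => by
      simp only [hU]; exact_mod_cast hx (t + 1)
    have hQ0 : |(qSeq x 0 : ℝ)| ≤ U 0 := by
      have := apply_card (DcardN x 0) (x 0)
      simpa [qSeq, hU, DcardN] using this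
    have hQs : ∀ t, |(qSeq x (t + 1) : ℝ) - qSeq x t| ≤ U (t + 1) - U t := by
      intro t
      have := apply_card (DcardN x (t + 1)) (x (t + 1))
      have e : U (t + 1) - U t = (x (t + 1)).2.card := by
        simp only [hU]
        rw [Finset.sum_range_succ _ (t + 1)]
        push_cast; ring
      rw [e]
      simpa [qSeq, DcardN] using this
    have hQU : ∀ t, (qSeq x t : ℝ) ≤ U t := by
      intro t
      induction t with
      | zero => exact (le_abs_self _).trans hQ0
      | succ t ih => linarith [hQs t, le_abs_self ((qSeq x (t + 1) : ℝ) - qSeq x t)]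
    have hBm : Monotone B := by
      intro a b hab
      simp only [hB, hL]
      have : (a : ℝ) ≤ b := by exact_mod_cast hab
      have hβ0 := hβ.1
      have h2 := log2c_mono (show ((a : ℝ) + 1) / β ≤ ((b : ℝ) + 1) / β by gcongr)
      gcongr
    have hsB : ∀ t, s ≤ B t := fun t => by
      simp only [hB]; nlinarith [hL1 t]
    have hinv := (svSt_inv S B s K (qSeq x) U ω hBm hs0 hsB
      (fun c hc => Nat.le_floor ((le_div_iff₀ hs0).2 hc)) hQ0 hQs hUK hω' n).1
    have hqe : (qSeq x n : ℝ) = ((DcardN x (n + 1)).card : ℝ) := by simp [qSeq]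
    have hqK : ((DcardN x (n + 1)).card : ℝ) ≤ K := by
      rw [← hqe]; exact (hQU n).trans (hUK n)
    have hqd : ((DcardN x (n + 1)).card : ℝ) ≤ d := by
      have := Finset.card_le_univ (DcardN x (n + 1))
      rw [Fintype.card_fin] at this
      exact_mod_cast this
    change |g n (svSt S θ (qSeq x) ω (n + 1)).1 - ((DcardN x (n + 1)).card : ℝ)| ≤
      192 * min (d : ℝ) (min (K : ℝ) (s * L n))
    rw [← min_assoc]
    simp only [hg]
    split_ifs with hc
    · rw [min_eq_left hc, zero_sub, abs_neg, abs_of_nonneg (by positivity)]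
      have h1 := le_min hqd hqK
      have h2 : (0 : ℝ) ≤ min (d : ℝ) K := by positivity
      linarith
    · rw [min_eq_right (not_le.1 hc).le, ← hqe]
      refine hinv.trans (le_of_eq ?_)
      simp only [hB]; ring
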